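/- arXiv:2210.11961 — 2 statements merged into one kernel-verified Lean document; each statement's English description precedes it below -/
import Mathlib

section
/- There does not exist a set of five mutually orthogoval projective planes of order 3. That is, there are no five families L₁, …, L₅ of 4-element subsets of a 13-element set, each family having the property that every two distinct points lie in exactly one of its members, such that for all i ≠ j every member of L_i intersects every member of L_j in at most two points. -/
namespace OrthoThree

/-- The six arrangements of three symbols. -/
def arr (a b c : ℕ) : List (List ℕ) :=
  [[a, b, c], [a, c, b], [b, a, c], [b, c, a], [c, a, b], [c, b, a]]

/-- Symbols in the same column (off the diagonal) are distinct. -/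
def colOK : List ℕ → Bool
  | [a01, a02, a03, a10, a12, a13, a20, a21, a23, a30, a31, a32] =>
    a10 != a20 && a10 != a30 && a20 != a30 && a01 != a21 && a01 != a31 && a21 != a31 &&
    a02 != a12 && a02 != a32 && a12 != a32 && a03 != a13 && a03 != a23 && a13 != a23
  | _ => false

/-- All candidate parallel classes, encoded as off-diagonal arrays. -/
def cands : List (List ℕ) :=
  ((arr 1 2 3).flatMap fun r0 => (arr 0 2 3).flatMap fun r1 =>
    (arr 0 1 3).flatMap fun r2 => (arr 0 1 2).map fun r3 => r0 ++ (r1 ++ (r2 ++ r3))).filter colOK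

/-- All entries of the list are distinct. -/
def nodupB : List ℕ → Bool
  | [] => true
  | a :: l => l.all (fun b => a != b) && nodupB l

/-- Two candidate classes never put the same two points together. -/
def comp (A B : List ℕ) : Bool := nodupB (List.zipWith (fun a b => 4 * a + b) A B)

theorem search : (cands.all fun A => let W := cands.filter (comp A)
    W.all fun B => W.all fun C => !comp B C) = true := by
  decide +kernel

theorem nodupB_of_nodup (l : List ℕ) (h : l.Nodup) : nodupB l = true := by
  induction l with
  | nil => rfl
  | cons a l ih =>
    rw [List.nodup_cons] at h
    simp only [nodupB, Bool.and_eq_true, List.all_eq_true, bne_iff_ne]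
    exact ⟨fun b hb hab => h.1 (hab ▸ hb), ih h.2⟩

/-- The off-diagonal cells in reading order. -/
def cells : List (Fin 4 × Fin 4) :=
  [(0, 1), (0, 2), (0, 3), (1, 0), (1, 2), (1, 3), (2, 0), (2, 1), (2, 3), (3, 0), (3, 1), (3, 2)]

def enc (A : Fin 4 → Fin 4 → Fin 4) : List ℕ := cells.map fun z => (A z.1 z.2 : ℕ)

theorem cells_nodup : cells.Nodup := by decide

theorem cells_off : ∀ z ∈ cells, z.1 ≠ z.2 := by decide

theorem comp_enc (A B : Fin 4 → Fin 4 → Fin 4)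
    (h : ∀ i j i' j', i ≠ j → i' ≠ j' → A i j = A i' j' → B i j = B i' j' → i = i' ∧ j = j') :
    comp (enc A) (enc B) = true := by
  apply nodupB_of_nodup
  unfold enc
  rw [List.zipWith_map, List.zipWith_self]
  refine List.Nodup.map_on ?_ cells_nodup
  intro x hx y hy hxy
  have h1 := (A x.1 x.2).isLt
  have h2 := (A y.1 y.2).isLt
  have h3 := (B x.1 x.2).isLt
  have h4 := (B y.1 y.2).isLt
  have := h x.1 x.2 y.1 y.2 (cells_off x hx) (cells_off y hy) (by ext; omega) (by ext; omega)
  exact Prod.ext this.1 this.2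

theorem row0 : ∀ a b c : Fin 4, a ≠ 0 → b ≠ 0 → c ≠ 0 → a ≠ b → a ≠ c → b ≠ c →
    [(a : ℕ), b, c] ∈ arr 1 2 3 := by decide
theorem row1 : ∀ a b c : Fin 4, a ≠ 1 → b ≠ 1 → c ≠ 1 → a ≠ b → a ≠ c → b ≠ c →
    [(a : ℕ), b, c] ∈ arr 0 2 3 := by decide
theorem row2 : ∀ a b c : Fin 4, a ≠ 2 → b ≠ 2 → c ≠ 2 → a ≠ b → a ≠ c → b ≠ c →
    [(a : ℕ), b, c] ∈ arr 0 1 3 := by decide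
theorem row3 : ∀ a b c : Fin 4, a ≠ 3 → b ≠ 3 → c ≠ 3 → a ≠ b → a ≠ c → b ≠ c →
    [(a : ℕ), b, c] ∈ arr 0 1 2 := by decide

/-- Row and column conditions for a parallel class. -/
structure Good (A : Fin 4 → Fin 4 → Fin 4) : Prop where
  ne : ∀ i j, i ≠ j → A i j ≠ i
  row : ∀ i j j', i ≠ j → i ≠ j' → j ≠ j' → A i j ≠ A i j'
  col : ∀ i i' j, i ≠ j → i' ≠ j → i ≠ i' → A i j ≠ A i' j

theorem enc_mem (A : Fin 4 → Fin 4 → Fin 4) (h : Good A) : enc A ∈ cands := by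
  unfold cands
  rw [List.mem_filter]
  constructor
  · simp only [List.mem_flatMap, List.mem_map]
    refine ⟨_, row0 (A 0 1) (A 0 2) (A 0 3) ?_ ?_ ?_ ?_ ?_ ?_,
      _, row1 (A 1 0) (A 1 2) (A 1 3) ?_ ?_ ?_ ?_ ?_ ?_,
      _, row2 (A 2 0) (A 2 1) (A 2 3) ?_ ?_ ?_ ?_ ?_ ?_,
      _, row3 (A 3 0) (A 3 1) (A 3 2) ?_ ?_ ?_ ?_ ?_ ?_, rfl⟩
    all_goals first
      | exact h.ne _ _ (by decide)
      | exact h.row _ _ _ (by decide) (by decide) (by decide)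
  · simp only [enc, cells, List.map, colOK, Bool.and_eq_true, bne_iff_ne, ne_eq, Fin.val_inj,
      and_assoc]
    refine ⟨?_, ?_, ?_, ?_, ?_, ?_, ?_, ?_, ?_, ?_, ?_, ?_⟩
    all_goals exact h.col _ _ _ (by decide) (by decide) (by decide)

/-- Two classes never put the same two points together. -/
def Compat (A B : Fin 4 → Fin 4 → Fin 4) : Prop :=
  ∀ i j i' j', i ≠ j → i' ≠ j' → A i j = A i' j' → B i j = B i' j' → i = i' ∧ j = j'

theorem no_three (A B C : Fin 4 → Fin 4 → Fin 4) (hA : Good A) (hB : Good B) (hC : Good C)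
    (hAB : Compat A B) (hAC : Compat A C) (hBC : Compat B C) : False := by
  have h := search
  simp only [List.all_eq_true, List.mem_filter] at h
  have := h _ (enc_mem A hA) _ ⟨enc_mem B hB, comp_enc A B hAB⟩ _ ⟨enc_mem C hC, comp_enc A C hAC⟩
  rw [comp_enc B C hBC] at this
  exact absurd this (by decide)

/-- There is no nearly Kirkman triple system of order 12. -/
theorem no_colorings {X : Type*} [Fintype X] [DecidableEq X] (c : Fin 5 → X → Fin 4)
    (hc : ∀ k v, (Finset.univ.filter fun x => c k x = v).card = 3)
    (hcc : ∀ k l, k ≠ l → ∀ x y, c k x = c k y → c l x = c l y → x = y) : False := by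
  have key : ∀ k l, k ≠ l → ∀ v, ∃ m, (∀ x, c k x = v → c l x ≠ m) ∧
      ∀ m', (∀ x, c k x = v → c l x ≠ m') → m' = m := by
    intro k l hkl v
    have h1 : ((Finset.univ.filter fun x => c k x = v).image (c l)).card = 3 := by
      rw [Finset.card_image_of_injOn, hc]
      intro x hx y hy hxy
      simp only [Finset.coe_filter, Finset.mem_univ, true_and, Set.mem_ofPred_eq] at hx hy
      exact hcc k l hkl x y (hx.trans hy.symm) hxy
    have h2 : ((Finset.univ.filter fun x => c k x = v).image (c l))ᶜ.card = 1 := by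
      rw [Finset.card_compl, h1]; rfl
    obtain ⟨m, hm⟩ := Finset.card_eq_one.1 h2
    have h3 : ∀ m', (∀ x, c k x = v → c l x ≠ m') ↔ m' = m := by
      intro m'
      rw [← Finset.mem_singleton, ← hm]
      simp
    exact ⟨m, (h3 m).2 rfl, fun m' h => (h3 m').1 h⟩
  have key2 : ∀ k : Fin 5, ∃ N : Fin 4 → Fin 4, k ≠ 0 →
      ∀ m, ∀ x, c k x = m → c 0 x ≠ N m := by
    intro k
    by_cases hk : k = 0
    · exact ⟨id, fun h => absurd hk h⟩
    · choose N hN using key k 0 hk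
      exact ⟨N, fun _ m => (hN m).1⟩
  choose N hN using key2
  have Ninj : ∀ k, k ≠ 0 → Function.Injective (N k) := by
    intro k hk m m' h
    obtain ⟨q, -, hq⟩ := key 0 k (Ne.symm hk) (N k m)
    rw [hq m (fun x hx hx' => hN k hk m x hx' hx),
      hq m' (fun x hx hx' => hN k hk m' x hx' (hx.trans h))]
  have pt : ∀ i j : Fin 4, ∃ x, i ≠ j → c 0 x = i ∧ N 1 (c 1 x) = j := by
    intro i j
    have h1 : (Finset.univ.filter fun x => c 0 x = i).image (fun x => N 1 (c 1 x))
        = Finset.univ.erase i := by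
      apply Finset.eq_of_subset_of_card_le
      · intro r hr
        simp only [Finset.mem_image, Finset.mem_filter, Finset.mem_univ, true_and] at hr
        obtain ⟨x, hx, rfl⟩ := hr
        simp only [Finset.mem_erase, Finset.mem_univ, and_true]
        intro h
        exact hN 1 (by decide) _ x rfl (hx.trans h.symm)
      · rw [Finset.card_image_of_injOn, hc]
        · simp
        intro x hx y hy hxy
        simp only [Finset.coe_filter, Finset.mem_univ, true_and, Set.mem_ofPred_eq] at hx hy
        exact hcc 0 1 (by decide) x y (hx.trans hy.symm) (Ninj 1 (by decide) hxy)
    by_cases hij : i = j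
    · have : (Finset.univ.filter fun x => c 0 x = 0).Nonempty := by
        rw [← Finset.card_pos, hc]; norm_num
      obtain ⟨x, -⟩ := this
      exact ⟨x, fun h => absurd hij h⟩
    · have : j ∈ (Finset.univ.filter fun x => c 0 x = i).image (fun x => N 1 (c 1 x)) := by
        rw [h1]; simp [Ne.symm hij]
      simp only [Finset.mem_image, Finset.mem_filter, Finset.mem_univ, true_and] at this
      obtain ⟨x, hx⟩ := this
      exact ⟨x, fun _ => hx⟩
  choose p hp using pt
  have good : ∀ k, k ≠ 0 → k ≠ 1 → Good (fun i j => N k (c k (p i j))) := by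
    intro k h0 h1
    refine ⟨?_, ?_, ?_⟩
    · intro i j hij h
      exact hN k h0 _ (p i j) rfl ((hp i j hij).1.trans h.symm)
    · intro i j j' hj hj' hne h
      have := hcc 0 k (Ne.symm h0) (p i j) (p i j')
        ((hp i j hj).1.trans (hp i j' hj').1.symm) (Ninj k h0 h)
      apply hne
      rw [← (hp i j hj).2, ← (hp i j' hj').2, this]
    · intro i i' j hi hi' hne h
      have := hcc 1 k (Ne.symm h1) (p i j) (p i' j)
        (Ninj 1 (by decide) ((hp i j hi).2.trans (hp i' j hi').2.symm)) (Ninj k h0 h)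
      apply hne
      rw [← (hp i j hi).1, ← (hp i' j hi').1, this]
  have compat : ∀ k l, k ≠ 0 → l ≠ 0 → k ≠ l →
      Compat (fun i j => N k (c k (p i j))) (fun i j => N l (c l (p i j))) := by
    intro k l hk hl hkl i j i' j' hij hij' h h'
    have := hcc k l hkl (p i j) (p i' j') (Ninj k hk h) (Ninj l hl h')
    constructor
    · rw [← (hp i j hij).1, ← (hp i' j' hij').1, this]
    · rw [← (hp i j hij).2, ← (hp i' j' hij').2, this]
  exact no_three _ _ _ (good 2 (by decide) (by decide)) (good 3 (by decide) (by decide))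
    (good 4 (by decide) (by decide)) (compat 2 3 (by decide) (by decide) (by decide))
    (compat 2 4 (by decide) (by decide) (by decide)) (compat 3 4 (by decide) (by decide) (by decide))

/-- The lines of a plane of order 3 through a point give a colouring of the other points. -/
theorem coloring {P : Type*} [Fintype P] [DecidableEq P] (hP : Fintype.card P = 13)
    (L : Set (Finset P)) (h4 : ∀ B ∈ L, B.card = 4)
    (hL : ∀ x y : P, x ≠ y → ∃! B : Finset P, B ∈ L ∧ x ∈ B ∧ y ∈ B) (p : P) :
    ∃ c : {x : P // x ≠ p} → Fin 4, (∀ v, (Finset.univ.filter fun x => c x = v).card = 3) ∧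
      ∀ x y, c x = c y → ∃ B ∈ L, p ∈ B ∧ x.1 ∈ B ∧ y.1 ∈ B := by
  have h1 : ∀ x : {x : P // x ≠ p}, ∃ B : Finset P, (B ∈ L ∧ p ∈ B ∧ x.1 ∈ B) ∧
      ∀ B', B' ∈ L → p ∈ B' → x.1 ∈ B' → B' = B := by
    intro x
    obtain ⟨B, hB, hu⟩ := hL p x.1 (Ne.symm x.2)
    exact ⟨B, hB, fun B' a b c => hu B' ⟨a, b, c⟩⟩
  choose f hf hu using h1
  have fib : ∀ B ∈ Finset.univ.image f, (Finset.univ.filter fun x => f x = B).card = 3 := by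
    intro B hB
    obtain ⟨y, -, rfl⟩ := Finset.mem_image.1 hB
    have : (Finset.univ.filter fun x => f x = f y).map (Function.Embedding.subtype _)
        = (f y).erase p := by
      ext z
      simp only [Finset.mem_map, Finset.mem_filter, Finset.mem_univ, true_and,
        Function.Embedding.subtype_apply, Finset.mem_erase]
      constructor
      · rintro ⟨x, hx, rfl⟩
        exact ⟨x.2, hx ▸ (hf x).2.2⟩
      · rintro ⟨hz, hz'⟩
        exact ⟨⟨z, hz⟩, (hu ⟨z, hz⟩ (f y) (hf y).1 (hf y).2.1 hz').symm, rfl⟩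
    rw [← Finset.card_map (Function.Embedding.subtype _), this,
      Finset.card_erase_of_mem (hf y).2.1, h4 _ (hf y).1]
  have hcard : (Finset.univ.image f).card = 4 := by
    have h := Finset.card_eq_sum_card_image f Finset.univ
    rw [Finset.sum_congr rfl fib, Finset.card_univ, Fintype.card_subtype_compl, hP] at h
    simp at h
    omega
  let e := Finset.equivFinOfCardEq hcard
  have hm : ∀ x, f x ∈ Finset.univ.image f := fun x => Finset.mem_image_of_mem f (Finset.mem_univ x)
  refine ⟨fun x => e ⟨f x, hm x⟩, ?_, ?_⟩
  · intro v
    rw [← fib (e.symm v).1 (e.symm v).2]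
    congr 1
    ext x
    simp only [Finset.mem_filter, Finset.mem_univ, true_and]
    rw [← Equiv.eq_symm_apply, Subtype.ext_iff]
  · intro x y hxy
    have : f x = f y := congrArg Subtype.val (e.injective hxy)
    exact ⟨f x, (hf x).1, (hf x).2.1, (hf x).2.2, this ▸ (hf y).2.2⟩

end OrthoThree



/-- There is no set of five mutually orthogoval projective planes of order 3:
on a 13-element point set there are no five families of 4-element blocks, each covering every
pair of distinct points exactly once, with blocks from distinct families meeting in at most
two points. -/
theorem no_five_mutually_orthogoval_projective_planes_order_three
    (P : Type*) [Fintype P] [DecidableEq P] (hP : Fintype.card P = 13) :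
    ¬ ∃ L : Fin 5 → Set (Finset P),
      (∀ i : Fin 5,
        (∀ B ∈ L i, B.card = 4) ∧
        (∀ x y : P, x ≠ y → ∃! B : Finset P, B ∈ L i ∧ x ∈ B ∧ y ∈ B)) ∧
      (∀ i j : Fin 5, i ≠ j →
        ∀ B₁ ∈ L i, ∀ B₂ ∈ L j, (B₁ ∩ B₂).card ≤ 2) := by

  rintro ⟨L, hL, hO⟩
  have hne : Nonempty P := Fintype.card_pos_iff.1 (by omega)
  obtain ⟨p⟩ := hne
  choose c hc hcc using fun k => OrthoThree.coloring hP (L k) (hL k).1 (hL k).2 p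
  refine OrthoThree.no_colorings c hc ?_
  intro k l hkl x y hk hl
  obtain ⟨B, hB, hpB, hxB, hyB⟩ := hcc k x y hk
  obtain ⟨D, hD, hpD, hxD, hyD⟩ := hcc l x y hl
  by_contra hxy
  have h2 := hO k l hkl B hB D hD
  have h3 : ({p, x.1, y.1} : Finset P).card = 3 :=
    Finset.card_eq_three.2 ⟨p, x.1, y.1, Ne.symm x.2, Ne.symm y.2,
      fun h => hxy (Subtype.ext h), rfl⟩
  have h4 : ({p, x.1, y.1} : Finset P) ⊆ B ∩ D := by
    intro z hz
    simp only [Finset.mem_insert, Finset.mem_singleton] at hz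
    rcases hz with rfl | rfl | rfl <;> simp [*]
  have := Finset.card_le_card h4
  omega
end

section
/- For each q ∈ {4, 8} there exists a set of seven mutually orthogoval affine planes of order q. That is, there exist seven families L₁, …, L₇ of q-element subsets of a q²-element set, each family having the property that every two distinct points lie in exactly one of its members, such that for all i ≠ j every member of L_i intersects every member of L_j in at most two points. -/
/-- Seven mutually orthogoval spreads of `GF(2)^4` by 2-dimensional subspaces (a packing of
`PG(3,2)`): the base-16 digit number `v` of entry `i` is the index of the member of the
`i`-th spread that contains the nonzero vector `v`. -/
def tabFour : List ℕ :=
  [2607920915104727055,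
   3613084480891265295,
   2540614116415054095,
   3549175157058904335,
   1446500129261625615,
   4827913931835121935,
   14676496292716815]

/-- Seven spreads of `GF(64) = GF(2)^6` by 3-dimensional subspaces, the orbit of a Sidon
space under the multiplicative group; same encoding. -/
def tabEight : List ℕ :=
  [59705668711349762123273087370120120443784918634183399500744117526065850643727,
   32794469193194909276893132206292011372853678706397072417942115136275510296687,
   60276129133257946766318828151490049274217897314690849754278068003948292216447,
   39130736424160052063843679505927228572191112519266269926066131593678095259407,
   47185793975646447316258273182573419240469989945021369559804912096363225219087,
   61696790294590092487994486941598892834865687786808251252608904489372954415247,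
   61292707252290722057848953173605950869799897662263566993115636565243964950607]

/-- The index of the spread member containing `v` in the `i`-th spread. -/
def colr (T : List ℕ) (i v : ℕ) : ℕ := (T.getD i 0 >>> (4 * v)) % 16

/-- Membership in the subspace number `j` of spread `i`. -/
def inSub (T : List ℕ) (i j v : ℕ) : Prop := v = 0 ∨ colr T i v = j

instance (T : List ℕ) (i j v : ℕ) : Decidable (inSub T i j v) := by
  unfold inSub; infer_instance

/-- The coset through `x` of subspace number `j` in spread `i`. -/
def blk (T : List ℕ) (n i j : ℕ) (x : Fin (2 ^ n)) : Finset (Fin (2 ^ n)) :=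
  Finset.univ.filter fun y => inSub T i j (x.val ^^^ y.val)

section general
variable {T : List ℕ} {n q : ℕ}

lemma xor_xor_base (x y z : ℕ) : (x ^^^ y) ^^^ (x ^^^ z) = y ^^^ z := by
  rw [Nat.xor_comm x y, Nat.xor_assoc, ← Nat.xor_assoc x x z, Nat.xor_self, Nat.zero_xor]

lemma inSub_xor
    (hC : ∀ i < 7, ∀ a < 2 ^ n, ∀ b < 2 ^ n, colr T i a = colr T i b → a ≠ 0 → b ≠ 0 → a ≠ b →
      colr T i (a ^^^ b) = colr T i a)
    {i j a b : ℕ} (hi : i < 7) (ha : a < 2 ^ n) (hb : b < 2 ^ n)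
    (h1 : inSub T i j a) (h2 : inSub T i j b) : inSub T i j (a ^^^ b) := by
  by_cases a0 : a = 0
  · subst a0; simpa using h2
  by_cases b0 : b = 0
  · subst b0; simpa using h1
  by_cases hab : a = b
  · subst hab; left; simp
  have e1 := h1.resolve_left a0
  have e2 := h2.resolve_left b0
  right
  rw [hC i hi a ha b hb (e1.trans e2.symm) a0 b0 hab, e1]

lemma blk_rebase
    (hC : ∀ i < 7, ∀ a < 2 ^ n, ∀ b < 2 ^ n, colr T i a = colr T i b → a ≠ 0 → b ≠ 0 → a ≠ b →
      colr T i (a ^^^ b) = colr T i a)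
    {i j : ℕ} (hi : i < 7) {x y : Fin (2 ^ n)} (h : y ∈ blk T n i j x) :
    blk T n i j x = blk T n i j y := by
  have h' : inSub T i j (x.val ^^^ y.val) := by simpa [blk] using h
  ext z
  simp only [blk, Finset.mem_filter, Finset.mem_univ, true_and]
  constructor
  · intro hz
    have := inSub_xor hC hi (Nat.xor_lt_two_pow x.2 y.2) (Nat.xor_lt_two_pow x.2 z.2) h' hz
    rwa [xor_xor_base] at this
  · intro hz
    have := inSub_xor hC hi (Nat.xor_lt_two_pow x.2 y.2) (Nat.xor_lt_two_pow y.2 z.2) h' hz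
    rwa [Nat.xor_comm x.val, xor_xor_base] at this

lemma colr_of_mem {i j : ℕ} {x y : Fin (2 ^ n)} (h : y ∈ blk T n i j x) (hxy : x ≠ y) :
    colr T i (x.val ^^^ y.val) = j := by
  have h' : inSub T i j (x.val ^^^ y.val) := by simpa [blk] using h
  refine h'.resolve_left fun h0 => hxy (Fin.ext ?_)
  exact Nat.xor_eq_zero_iff.1 h0

lemma self_mem_blk {i j : ℕ} (x : Fin (2 ^ n)) : x ∈ blk T n i j x := by
  simp [blk, inSub]

lemma blk_card
    (hK : ∀ i < 7, ∀ j < q + 1, ((List.range (2 ^ n)).filter fun v => inSub T i j v).length = q)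
    {i j : ℕ} (hi : i < 7) (hj : j < q + 1) (x : Fin (2 ^ n)) : (blk T n i j x).card = q := by
  rw [← hK i hi j hj]
  have : ((List.range (2 ^ n)).filter fun v => inSub T i j v).length
      = ((Finset.range (2 ^ n)).filter fun v => inSub T i j v).card := by
    rfl
  rw [this]
  refine Finset.card_bij (fun y _ => x.val ^^^ y.val) ?_ ?_ ?_
  · intro y hy
    simp only [blk, Finset.mem_filter, Finset.mem_univ, true_and] at hy
    simp only [Finset.mem_filter, Finset.mem_range]
    exact ⟨Nat.xor_lt_two_pow x.2 y.2, hy⟩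
  · intro a _ b _ h
    exact Fin.ext (Nat.xor_right_injective h)
  · intro b hb
    simp only [Finset.mem_filter, Finset.mem_range] at hb
    refine ⟨⟨x.val ^^^ b, Nat.xor_lt_two_pow x.2 hb.1⟩, ?_, ?_⟩
    · simp only [blk, Finset.mem_filter, Finset.mem_univ, true_and, ← Nat.xor_assoc, Nat.xor_self,
        Nat.zero_xor]
      exact hb.2
    · simp

theorem planes_of_table (P : Type*) [Fintype P] [DecidableEq P] (hP : Fintype.card P = 2 ^ n)
    (hC : ∀ i < 7, ∀ a < 2 ^ n, ∀ b < 2 ^ n, colr T i a = colr T i b → a ≠ 0 → b ≠ 0 → a ≠ b →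
      colr T i (a ^^^ b) = colr T i a)
    (hR : ∀ i < 7, ∀ a < 2 ^ n, a ≠ 0 → colr T i a < q + 1)
    (hK : ∀ i < 7, ∀ j < q + 1, ((List.range (2 ^ n)).filter fun v => inSub T i j v).length = q)
    (hI : ∀ i < 7, ∀ a < 2 ^ n, ∀ b < a, colr T i a = colr T i b → b ≠ 0 →
      ∀ k < i, colr T k a ≠ colr T k b) :
    ∃ L : Fin 7 → Set (Finset P),
      (∀ i : Fin 7,
        (∀ B ∈ L i, B.card = q) ∧
        (∀ x y : P, x ≠ y → ∃! B : Finset P, B ∈ L i ∧ x ∈ B ∧ y ∈ B)) ∧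
      (∀ i j : Fin 7, i ≠ j →
        ∀ B₁ ∈ L i, ∀ B₂ ∈ L j, (B₁ ∩ B₂).card ≤ 2) := by
  -- the symmetric form of `hI`
  have hI' : ∀ i < 7, ∀ k < 7, i ≠ k → ∀ a < 2 ^ n, ∀ b < 2 ^ n, a ≠ 0 → b ≠ 0 → a ≠ b →
      colr T i a = colr T i b → colr T k a ≠ colr T k b := by
    intro i hi k hk hik a ha b hb a0 b0 hab h1 h2
    rcases lt_or_gt_of_ne hik with h | h <;> rcases lt_or_gt_of_ne hab with h' | h'
    · exact hI k hk b hb a h' h2.symm a0 i h h1.symm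
    · exact hI k hk a ha b h' h2 b0 i h h1
    · exact hI i hi b hb a h' h1.symm a0 k h h2.symm
    · exact hI i hi a ha b h' h1 b0 k h h2
  let e : P ≃ Fin (2 ^ n) := Fintype.equivFinOfCardEq hP
  refine ⟨fun i => {B | ∃ j < q + 1, ∃ x, B = (blk T n i j x).map e.symm.toEmbedding},
    fun i => ⟨?_, ?_⟩, ?_⟩
  · rintro B ⟨j, hj, x, rfl⟩
    rw [Finset.card_map]
    exact blk_card hK i.2 hj x
  · intro x y hxy
    have hxy' : e x ≠ e y := fun h => hxy (e.injective h)
    have h0 : (e x).val ^^^ (e y).val ≠ 0 := fun h =>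
      hxy' (Fin.ext (Nat.xor_eq_zero_iff.1 h))
    refine ⟨(blk T n i (colr T i ((e x).val ^^^ (e y).val)) (e x)).map e.symm.toEmbedding,
      ⟨⟨_, hR i i.2 _ (Nat.xor_lt_two_pow (e x).2 (e y).2) h0, _, rfl⟩, ?_, ?_⟩, ?_⟩
    · rw [Finset.mem_map_equiv]
      exact self_mem_blk _
    · rw [Finset.mem_map_equiv]
      simp [blk, inSub]
    · rintro B ⟨⟨j, hj, z, rfl⟩, hx, hy⟩
      rw [Finset.mem_map_equiv] at hx hy
      simp only [Equiv.symm_symm] at hx hy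
      rw [blk_rebase hC i.2 hx] at hy ⊢
      rw [colr_of_mem hy hxy']
  · rintro i k hik B₁ ⟨j, hj, u, rfl⟩ B₂ ⟨l, hl, v, rfl⟩
    rw [← Finset.map_inter, Finset.card_map]
    by_contra hcon
    obtain ⟨x, y, z, hx, hy, hz, hxy, hxz, hyz⟩ := Finset.two_lt_card_iff.1 (not_le.1 hcon)
    rw [Finset.mem_inter] at hx hy hz
    rw [blk_rebase hC i.2 hx.1, blk_rebase hC k.2 hx.2] at hy hz
    have n1 : x.val ^^^ y.val ≠ 0 := fun h => hxy (Fin.ext (Nat.xor_eq_zero_iff.1 h))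
    have n2 : x.val ^^^ z.val ≠ 0 := fun h => hxz (Fin.ext (Nat.xor_eq_zero_iff.1 h))
    have n3 : x.val ^^^ y.val ≠ x.val ^^^ z.val := fun h =>
      hyz (Fin.ext (Nat.xor_right_injective h))
    exact hI' i i.2 k k.2 (fun h => hik (Fin.ext h)) _ (Nat.xor_lt_two_pow x.2 y.2) _
      (Nat.xor_lt_two_pow x.2 z.2) n1 n2 n3
      ((colr_of_mem hy.1 hxy).trans (colr_of_mem hz.1 hxz).symm)
      ((colr_of_mem hy.2 hxy).trans (colr_of_mem hz.2 hxz).symm)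

end general


set_option synthInstance.maxHeartbeats 400000
set_option synthInstance.maxSize 4096

/-- For `q ∈ {4, 8}` there exists a set of seven mutually orthogoval affine
planes of order `q`: on a `q²`-element point set there are seven families of `q`-element
blocks, each covering every pair of distinct points exactly once, with blocks from distinct
families meeting in at most two points. -/
theorem seven_mutually_orthogoval_affine_planes_order_four_eight
    (q : ℕ) (hq : q ∈ ({4, 8} : Set ℕ))
    (P : Type*) [Fintype P] [DecidableEq P] (hP : Fintype.card P = q ^ 2) :
    ∃ L : Fin 7 → Set (Finset P),
      (∀ i : Fin 7,
        (∀ B ∈ L i, B.card = q) ∧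
        (∀ x y : P, x ≠ y → ∃! B : Finset P, B ∈ L i ∧ x ∈ B ∧ y ∈ B)) ∧
      (∀ i j : Fin 7, i ≠ j →
        ∀ B₁ ∈ L i, ∀ B₂ ∈ L j, (B₁ ∩ B₂).card ≤ 2) := by
  have hq' : q = 4 ∨ q = 8 := by simpa using hq
  rcases hq' with rfl | rfl
  · exact planes_of_table (T := tabFour) (n := 4) (q := 4) P (by simpa using hP)
      (by decide +kernel) (by decide +kernel) (by decide +kernel) (by decide +kernel)
  · exact planes_of_table (T := tabEight) (n := 6) (q := 8) P (by simpa using hP)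
      (by decide +kernel) (by decide +kernel) (by decide +kernel) (by decide +kernel)
end
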